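/- arXiv:1808.10370 — 4 statements merged into one kernel-verified Lean document; each statement's English description precedes it below -/
import Mathlib

section
/- Let u and u' be true twins in a finite simple graph G and let X be an inclusionwise minimal hitting set of G. Then u ∈ X if and only if u' ∈ X; that is, X contains both of the true twins or none of them. -/
/-- An induced `P₃` in `G`: three distinct vertices `a, b, c` such that
`ab` and `bc` are edges of `G` and `ac` is not an edge. -/
def IsInducedP3 {V : Type*} (G : SimpleGraph V) (a b c : V) : Prop :=
  a ≠ c ∧ G.Adj a b ∧ G.Adj b c ∧ ¬ G.Adj a c

/-- A hitting set of `G`: a set of vertices intersecting every induced `P₃`. -/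
def IsHittingSet {V : Type*} (G : SimpleGraph V) (X : Set V) : Prop :=
  ∀ a b c : V, IsInducedP3 G a b c → a ∈ X ∨ b ∈ X ∨ c ∈ X

/-- `u` and `u'` are true twins in `G`: they are adjacent and every vertex
`w ∉ {u, u'}` is adjacent to `u` iff it is adjacent to `u'`. -/
def TrueTwins {V : Type*} (G : SimpleGraph V) (u u' : V) : Prop :=
  G.Adj u u' ∧ ∀ w : V, w ≠ u → w ≠ u' → (G.Adj w u ↔ G.Adj w u')

theorem TrueTwins.symm {V : Type*} {G : SimpleGraph V} {u u' : V} (h : TrueTwins G u u') :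
    TrueTwins G u' u :=
  ⟨h.1.symm, fun w hw hw' => (h.2 w hw' hw).symm⟩

/-- A minimal hitting set that contains a vertex contains all its true twins: otherwise deleting
the vertex leaves a hitting set, since in an induced `P₃` through it the vertex can be replaced
by its twin. -/
theorem TrueTwins.mem_of_mem {V : Type*} {G : SimpleGraph V} {u u' : V} (h : TrueTwins G u u')
    {X : Set V} (hX : IsHittingSet G X)
    (hmin : ∀ Y : Set V, Y ⊆ X → IsHittingSet G Y → Y = X) (hu : u ∈ X) : u' ∈ X := by
  by_contra hu'
  suffices hY : IsHittingSet G (X \ {u}) by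
    have hmem : u ∈ X \ {u} := (hmin _ Set.sdiff_subset hY).symm ▸ hu
    exact hmem.2 rfl
  rintro a b c ⟨hac, hab, hbc, hnac⟩
  obtain ⟨hadj, htwin⟩ := h
  by_contra! hcon
  simp only [Set.mem_sdiff, Set.mem_singleton_iff, not_and, not_not] at hcon
  obtain ⟨ha, hb, hc⟩ := hcon
  have hne := hab.ne
  have hne' := hbc.ne
  have hmem := hX a b c ⟨hac, hab, hbc, hnac⟩
  have hleft := hX u' b c
  have hmid := hX a u' c
  have hright := hX a b u'
  simp only [IsInducedP3] at hleft hmid hright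
  grind [SimpleGraph.adj_comm]

/-- If `u` and `u'` are true twins in `G` and `X` is an inclusionwise minimal
hitting set of `G`, then `u ∈ X` iff `u' ∈ X`: `X` contains both of the true
twins or none of them. -/
theorem stmt_7 {V : Type*} [Fintype V] (G : SimpleGraph V) (u u' : V)
    (h : TrueTwins G u u') (X : Set V) (hX : IsHittingSet G X)
    (hmin : ∀ Y : Set V, Y ⊆ X → IsHittingSet G Y → Y = X) :
    (u ∈ X ↔ u' ∈ X) := by
  exact ⟨h.mem_of_mem hX hmin, h.symm.mem_of_mem hX hmin⟩
end

section
/- Let u and u' be true twins in a finite simple graph G and let X' be a hitting set of the graph G − u'. If u ∈ X', then X' ∪ {u'} is a hitting set of G; if u ∉ X', then X' itself is a hitting set of G. -/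
/-- A hitting set of `G - u'` meets every induced `P₃` of `G` that avoids `u'`. -/
theorem IsHittingSet.mem_image_val_of_induce_compl {V : Type*} {G : SimpleGraph V} {u' : V}
    {X' : Set (({u'}ᶜ : Set V))} (hX' : IsHittingSet (G.induce ({u'}ᶜ : Set V)) X')
    {a b c : V} (ha : a ≠ u') (hb : b ≠ u') (hc : c ≠ u') (habc : IsInducedP3 G a b c) :
    a ∈ Subtype.val '' X' ∨ b ∈ Subtype.val '' X' ∨ c ∈ Subtype.val '' X' := by
  obtain ⟨hac, hab, hbc, hnac⟩ := habc
  rcases hX' ⟨a, ha⟩ ⟨b, hb⟩ ⟨c, hc⟩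
    ⟨fun e => hac (congrArg Subtype.val e), hab, hbc, hnac⟩ with h | h | h
  · exact Or.inl ⟨_, h, rfl⟩
  · exact Or.inr (Or.inl ⟨_, h, rfl⟩)
  · exact Or.inr (Or.inr ⟨_, h, rfl⟩)

theorem IsInducedP3.symm {V : Type*} {G : SimpleGraph V} {a b c : V}
    (h : IsInducedP3 G a b c) : IsInducedP3 G c b a :=
  ⟨h.1.symm, h.2.2.1.symm, h.2.1.symm, fun e => h.2.2.2 e.symm⟩

/-- An end `u'` of an induced `P₃` can be replaced by a true twin of `u'`. -/
theorem TrueTwins.isInducedP3_left {V : Type*} {G : SimpleGraph V} {u u' b c : V}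
    (h : TrueTwins G u u') (hP : IsInducedP3 G u' b c) : IsInducedP3 G u b c := by
  obtain ⟨hne, hab, hbc, hnac⟩ := hP
  have hcu : c ≠ u := fun e => hnac (e ▸ h.1.symm)
  have hc := h.2 c hcu hne.symm
  have hbu : b ≠ u := fun e => hnac (hc.1 (e ▸ hbc.symm)).symm
  exact ⟨hcu.symm, ((h.2 b hbu hab.ne').2 hab.symm).symm, hbc,
    fun e => hnac (hc.1 e.symm).symm⟩

/-- The middle vertex `u'` of an induced `P₃` can be replaced by a true twin of `u'`. -/
theorem TrueTwins.isInducedP3_middle {V : Type*} {G : SimpleGraph V} {u u' a c : V}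
    (h : TrueTwins G u u') (hP : IsInducedP3 G a u' c) : IsInducedP3 G a u c := by
  obtain ⟨hne, hab, hbc, hnac⟩ := hP
  have hau : a ≠ u := by
    rintro rfl
    exact hnac ((h.2 c hne.symm hbc.ne').2 hbc.symm).symm
  have hcu : c ≠ u := by
    rintro rfl
    exact hnac ((h.2 a hne hab.ne).2 hab)
  exact ⟨hne, (h.2 a hau hab.ne).2 hab, ((h.2 c hcu hbc.ne').2 hbc.symm).symm, hnac⟩

/-- Let `u, u'` be true twins in `G` and let `X'` be a hitting set of `G − u'`
(the subgraph induced on `V(G) \ {u'}`).  If `u ∈ X'`, then `X' ∪ {u'}` is a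
hitting set of `G`; if `u ∉ X'`, then `X'` itself is a hitting set of `G`. -/
theorem stmt_8 {V : Type*} [Fintype V] (G : SimpleGraph V) (u u' : V)
    (h : TrueTwins G u u')
    (X' : Set (({u'}ᶜ : Set V)))
    (hX' : IsHittingSet (G.induce ({u'}ᶜ : Set V)) X') :
    (u ∈ Subtype.val '' X' →
      IsHittingSet G (Subtype.val '' X' ∪ {u'})) ∧
    (u ∉ Subtype.val '' X' →
      IsHittingSet G (Subtype.val '' X')) := by
  refine ⟨fun _ a b c hP => ?_, fun hu a b c hP => ?_⟩
  · by_cases ha : a = u'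
    · exact Or.inl (Or.inr ha)
    by_cases hb : b = u'
    · exact Or.inr (Or.inl (Or.inr hb))
    by_cases hc : c = u'
    · exact Or.inr (Or.inr (Or.inr hc))
    exact (hX'.mem_image_val_of_induce_compl ha hb hc hP).imp Or.inl (Or.imp Or.inl Or.inl)
  · have huu' : u ≠ u' := h.1.ne
    by_cases ha : a = u'
    · subst ha
      exact Or.inr ((hX'.mem_image_val_of_induce_compl huu' hP.2.1.ne' hP.1.symm
        (h.isInducedP3_left hP)).resolve_left hu)
    by_cases hc : c = u'
    · subst hc
      have := hX'.mem_image_val_of_induce_compl ha hP.2.2.1.ne huu'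
        (h.isInducedP3_left hP.symm).symm
      tauto
    by_cases hb : b = u'
    · subst hb
      have := hX'.mem_image_val_of_induce_compl ha huu' hc (h.isInducedP3_middle hP)
      tauto
    exact hX'.mem_image_val_of_induce_compl ha hb hc hP
end

section
/- Let H be a finite simple graph whose vertex set is partitioned into a clique C and a distinguishing set D for C, and fix w ∈ D. Then the set M of edges uv of the clique C that are distinguished by w but by no other vertex of D forms a matching (no two edges of M share an endpoint). -/
/-- `w` distinguishes the edge `uv`: `w` is adjacent to exactly one of `u`, `v`. -/
def Distinguishes {V : Type*} (G : SimpleGraph V) (w u v : V) : Prop :=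
  Xor' (G.Adj w u) (G.Adj w v)

/-- `u` and `v` are true twins in the subgraph of `G` induced on `S`: they are
adjacent and every other vertex of `S` is adjacent to `u` iff it is adjacent to `v`. -/
def TrueTwinsIn {V : Type*} (G : SimpleGraph V) (S : Set V) (u v : V) : Prop :=
  G.Adj u v ∧ ∀ w ∈ S, w ≠ u → w ≠ v → (G.Adj w u ↔ G.Adj w v)

/-- `D` is a distinguishing set for `S`: `D` is disjoint from `S` and for every
edge `uv` with both endpoints in `S` whose endpoints are true twins in `G[S]`,
`D` contains a distinguisher for `uv`. -/
def DistinguishingSet {V : Type*} (G : SimpleGraph V) (S D : Set V) : Prop :=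
  Disjoint S D ∧ ∀ u ∈ S, ∀ v ∈ S, G.Adj u v → TrueTwinsIn G S u v →
    ∃ w ∈ D, Distinguishes G w u v

theorem distinguishes_iff {V : Type*} {G : SimpleGraph V} {w u v : V} :
    Distinguishes G w u v ↔ ¬(G.Adj w u ↔ G.Adj w v) :=
  xor_iff_not_iff _ _

theorem Distinguishes.comm {V : Type*} {G : SimpleGraph V} {w u v : V} :
    Distinguishes G w u v ↔ Distinguishes G w v u := by
  rw [distinguishes_iff, distinguishes_iff, iff_comm (a := G.Adj w u)]

/-- In a clique with distinguishing set `D`, two edges `ab` and `ac` that are distinguished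
by `w` and by no other vertex of `D` coincide. -/
theorem DistinguishingSet.eq_of_unique_distinguisher {V : Type*} {G : SimpleGraph V}
    {C D : Set V} (hC : G.IsClique C) (hD : DistinguishingSet G C D) {w a b c : V}
    (hb : b ∈ C) (hc : c ∈ C)
    (hwb : Distinguishes G w a b) (hxb : ∀ x ∈ D, x ≠ w → ¬ Distinguishes G x a b)
    (hwc : Distinguishes G w a c) (hxc : ∀ x ∈ D, x ≠ w → ¬ Distinguishes G x a c) :
    b = c := by
  by_contra hbc
  have htwins : TrueTwinsIn G C b c :=
    ⟨hC hb hc hbc, fun x hx hne hne' => iff_of_true (hC hx hb hne) (hC hx hc hne')⟩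
  obtain ⟨x, hxD, hx⟩ := hD.2 b hb c hc (hC hb hc hbc) htwins
  by_cases hxw : x = w
  · subst hxw
    rw [distinguishes_iff] at hx hwb hwc
    tauto
  · have h₁ := hxb x hxD hxw
    have h₂ := hxc x hxD hxw
    rw [distinguishes_iff] at hx h₁ h₂
    tauto

/-- Let `H` be a graph whose vertex set is partitioned into a clique `C` and a
distinguishing set `D` for `C`, and fix `w ∈ D`.  Then the set of edges `uv` of
`C` distinguished by `w` but by no other vertex of `D` forms a matching: any two
such edges sharing an endpoint are equal. -/
theorem stmt_10 {V : Type*} [Fintype V] (H : SimpleGraph V) (C D : Set V)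
    (hpart : C ∪ D = Set.univ) (hdisj : Disjoint C D)
    (hC : H.IsClique C) (hD : DistinguishingSet H C D)
    (w : V) (hw : w ∈ D) :
    ∀ u v u' v' : V, u ∈ C → v ∈ C → u ≠ v → u' ∈ C → v' ∈ C → u' ≠ v' →
      Distinguishes H w u v → (∀ x ∈ D, x ≠ w → ¬ Distinguishes H x u v) →
      Distinguishes H w u' v' → (∀ x ∈ D, x ≠ w → ¬ Distinguishes H x u' v') →
      (({u, v} : Set V) ∩ ({u', v'} : Set V)).Nonempty →
      ({u, v} : Set V) = ({u', v'} : Set V) := by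
  intro u v u' v' hu hv _ hu' hv' _ h hx h' hx' hne
  have hs : ∀ x ∈ D, x ≠ w → ¬ Distinguishes H x v u := fun x hxD hxw hd =>
    hx x hxD hxw (Distinguishes.comm.1 hd)
  have hs' : ∀ x ∈ D, x ≠ w → ¬ Distinguishes H x v' u' := fun x hxD hxw hd =>
    hx' x hxD hxw (Distinguishes.comm.1 hd)
  have hw₁ := Distinguishes.comm.1 h
  have hw₂ := Distinguishes.comm.1 h'
  obtain ⟨a, rfl | rfl, rfl | rfl⟩ := hne
  · rw [hD.eq_of_unique_distinguisher hC hv hv' h hx h' hx']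
  · rw [hD.eq_of_unique_distinguisher hC hv hu' h hx hw₂ hs', Set.pair_comm]
  · rw [hD.eq_of_unique_distinguisher hC hu hv' hw₁ hs h' hx', Set.pair_comm]
  · rw [hD.eq_of_unique_distinguisher hC hu hu' hw₁ hs hw₂ hs']
end

section
/- Let G be a finite simple graph containing no induced 4-cycle, let v0 be a vertex of G, and let A and A' be two distinct connected components of the subgraph induced on N(v0). Then no vertex w ∈ V(G) \ ({v0} ∪ N(v0)) has a neighbor in both A and A'. In particular, for distinct components A_i of G[N(v0)], the sets B_i of vertices outside {v0} ∪ N(v0) having a neighbor in A_i are pairwise disjoint. -/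
/-- Let `G` contain no induced 4-cycle, let `v₀` be a vertex, and let `a, a'`
be neighbors of `v₀` lying in two distinct connected components of the subgraph
induced on `N(v₀)` (i.e. `a` and `a'` are not reachable from each other in
`G[N(v₀)]`).  Then no vertex `w ∉ {v₀} ∪ N(v₀)` is adjacent to both `a` and
`a'`.  (In particular, the sets `Bᵢ` of outside vertices with a neighbor in the
component `Aᵢ` are pairwise disjoint.) -/
theorem stmt_17 {V : Type*} [Fintype V] (G : SimpleGraph V)
    (hC4free : ¬ ∃ a b c d : V, a ≠ c ∧ b ≠ d ∧
      G.Adj a b ∧ G.Adj b c ∧ G.Adj c d ∧ G.Adj d a ∧ ¬ G.Adj a c ∧ ¬ G.Adj b d)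
    (v₀ : V) (a a' : G.neighborSet v₀)
    (hcomp : ¬ (G.induce (G.neighborSet v₀)).Reachable a a')
    (w : V) (hw₁ : w ≠ v₀) (hw₂ : ¬ G.Adj v₀ w) :
    ¬ (G.Adj w a ∧ G.Adj w a') := by
  rintro ⟨hwa, hwa'⟩
  refine hC4free ⟨v₀, a, w, a', hw₁.symm, fun h => hcomp ?_, a.2, hwa.symm, hwa', a'.2.symm, hw₂,
    fun h => hcomp ?_⟩
  · rw [Subtype.ext h]
  · exact SimpleGraph.Adj.reachable (G := G.induce (G.neighborSet v₀)) h
end
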